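/- arXiv:1601.02818 — 3 statements merged into one kernel-verified Lean document; each statement's English description precedes it below -/
import Mathlib

section
/- Let k ≥ 1, let A_1, …, A_k be nonempty finite subsets of ℝ^n, and let ω_i : A_i → ℝ be lift functions. Define the lifted polyhedron L(A_i, ω_i) := conv{(a, ω_i(a)) : a ∈ A_i} + ({0}^n × ℝ_{≤0}) ⊆ ℝ^{n+1}, and the lifted Cayley configuration Cay := {(a, ω_i(a), e_i) ∈ ℝ^n × ℝ × ℝ^k : 1 ≤ i ≤ k, a ∈ A_i}. Then (1/k) • (L(A_1, ω_1) + ⋯ + L(A_k, ω_k)) = {y ∈ ℝ^{n+1} : (y, 1/k, …, 1/k) ∈ conv(Cay) + ({0}^n × ℝ_{≤0} × {0}^k)}, where + denotes Minkowski sum and • scalar dilation. -/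
open Pointwise

/-- **Cayley trick.** A point with weight coordinates `w` in the convex hull of the Cayley
configuration of the family `S` is a sum of points of the dilates `w i • convexHull ℝ (S i)`. -/
theorem exists_sum_of_mem_convexHull_cayley {ι E : Type*} [Fintype ι] [DecidableEq ι]
    [AddCommGroup E] [Module ℝ E] {S : ι → Set E} (hS : ∀ i, (S i).Nonempty) {q : E × (ι → ℝ)}
    (hq : q ∈ convexHull ℝ {q : E × (ι → ℝ) | ∃ i, ∃ s ∈ S i, q = (s, Pi.single i 1)}) :
    ∃ r : ι → E, (∀ i, r i ∈ q.2 i • convexHull ℝ (S i)) ∧ ∑ i, r i = q.1 := by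
  let T : Set (E × (ι → ℝ)) := {q | (∀ i, 0 ≤ q.2 i) ∧
    ∃ r : ι → E, (∀ i, r i ∈ q.2 i • convexHull ℝ (S i)) ∧ ∑ i, r i = q.1}
  suffices h : convexHull ℝ {q : E × (ι → ℝ) | ∃ i, ∃ s ∈ S i, q = (s, Pi.single i 1)} ⊆ T from
    (h hq).2
  refine convexHull_min ?_ ?_
  · rintro _ ⟨i, s, hs, rfl⟩
    refine ⟨fun j => ?_, Pi.single i s, fun j => ?_, by simp⟩
    · by_cases h : j = i
      · subst h; simp
      · simp [h]
    · by_cases h : j = i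
      · subst h; simpa using subset_convexHull ℝ _ hs
      · simp [h, Set.zero_smul_set ((hS j).convexHull (𝕜 := ℝ))]
  · rintro ⟨x, v⟩ ⟨hv, r, hr, hx⟩ ⟨y, w⟩ ⟨hw, t, ht, hy⟩ a b ha hb -
    refine ⟨fun i => add_nonneg (mul_nonneg ha (hv i)) (mul_nonneg hb (hw i)),
      fun i => a • r i + b • t i, fun i => ?_, ?_⟩
    · change _ ∈ (a * v i + b * w i) • convexHull ℝ (S i)
      rw [(convex_convexHull ℝ (S i)).add_smul (mul_nonneg ha (hv i)) (mul_nonneg hb (hw i)),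
        mul_smul, mul_smul]
      exact Set.add_mem_add (Set.smul_mem_smul_set (hr i)) (Set.smul_mem_smul_set (ht i))
    · simp only [Finset.sum_add_distrib, ← Finset.smul_sum, hx, hy]
      rfl

/-- Weighted sums of points of the convex hulls of the `S i` lie in the convex hull of the Cayley
configuration of `S`. -/
theorem sum_smul_mem_convexHull_cayley {ι E : Type*} [Fintype ι] [DecidableEq ι]
    [AddCommGroup E] [Module ℝ E] {S : ι → Set E} {w : ι → ℝ} (hw : ∀ i, 0 ≤ w i)
    (hw1 : ∑ i, w i = 1) {p : ι → E} (hp : ∀ i, p i ∈ convexHull ℝ (S i)) :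
    (∑ i, w i • p i, w) ∈
      convexHull ℝ {q : E × (ι → ℝ) | ∃ i, ∃ s ∈ S i, q = (s, Pi.single i 1)} := by
  have hmem : ∀ i, (p i, (Pi.single i 1 : ι → ℝ)) ∈
      convexHull ℝ {q : E × (ι → ℝ) | ∃ i, ∃ s ∈ S i, q = (s, Pi.single i 1)} := by
    intro i
    have h : (p i, (Pi.single i 1 : ι → ℝ)) ∈ convexHull ℝ (S i ×ˢ {Pi.single i (1 : ℝ)}) := by
      rw [convexHull_prod]
      exact ⟨hp i, by simp⟩
    refine convexHull_mono ?_ h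
    rintro ⟨s, e⟩ ⟨hs, rfl⟩
    exact ⟨i, s, hs, rfl⟩
  have h := (convex_convexHull ℝ
    {q : E × (ι → ℝ) | ∃ i, ∃ s ∈ S i, q = (s, Pi.single i 1)}).sum_mem
    (fun i _ => hw i) hw1 (fun i _ => hmem i)
  convert h using 1
  refine Prod.ext (by simp [Prod.fst_sum]) ?_
  ext j
  simp [Prod.snd_sum, Finset.sum_apply, Pi.single_apply]

/-- Cayley trick for the lifted polyhedra:
`(1/k) • (L(A₁,ω₁) + ⋯ + L(A_k,ω_k))`
equals the slice at last coordinates `(1/k,…,1/k)` of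
`conv(lifted Cayley configuration) + ({0}ⁿ × ℝ_{≤0} × {0}^k)`. -/
theorem cayley_trick_lifted (n k : ℕ) (hk : 1 ≤ k) (A : Fin k → Set (Fin n → ℝ))
    (hfin : ∀ i, (A i).Finite) (hne : ∀ i, (A i).Nonempty)
    (ω : Fin k → (Fin n → ℝ) → ℝ) :
    (1 / (k : ℝ)) •
        (∑ i, (convexHull ℝ {p : (Fin n → ℝ) × ℝ | ∃ a ∈ A i, p = (a, ω i a)} +
          {p : (Fin n → ℝ) × ℝ | p.1 = 0 ∧ p.2 ≤ 0})) =
      {y : (Fin n → ℝ) × ℝ |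
        ((y, fun _ : Fin k => 1 / (k : ℝ)) : ((Fin n → ℝ) × ℝ) × (Fin k → ℝ)) ∈
          convexHull ℝ
              {q : ((Fin n → ℝ) × ℝ) × (Fin k → ℝ) |
                ∃ i : Fin k, ∃ a ∈ A i, q = ((a, ω i a), Pi.single i 1)} +
            {q : ((Fin n → ℝ) × ℝ) × (Fin k → ℝ) |
              q.1.1 = 0 ∧ q.1.2 ≤ 0 ∧ q.2 = 0}} := by
  have hk0 : (k : ℝ) ≠ 0 := by positivity
  set S : Fin k → Set ((Fin n → ℝ) × ℝ) := fun i => {p | ∃ a ∈ A i, p = (a, ω i a)}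
  have hS : ∀ i, (S i).Nonempty := fun i => let ⟨a, ha⟩ := hne i; ⟨_, a, ha, rfl⟩
  have hCay : {q : ((Fin n → ℝ) × ℝ) × (Fin k → ℝ) |
      ∃ i : Fin k, ∃ a ∈ A i, q = ((a, ω i a), Pi.single i 1)} =
      {q | ∃ i, ∃ s ∈ S i, q = (s, Pi.single i 1)} := by
    ext q
    constructor
    · rintro ⟨i, a, ha, rfl⟩
      exact ⟨i, _, ⟨a, ha, rfl⟩, rfl⟩
    · rintro ⟨i, _, ⟨a, ha, rfl⟩, rfl⟩
      exact ⟨i, a, ha, rfl⟩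
  rw [hCay]
  ext y
  constructor
  · rintro ⟨z, hz, rfl⟩
    obtain ⟨g, hg, rfl⟩ := (Set.mem_fintype_sum _ _).1 hz
    choose p hp c hc hpc using hg
    refine ⟨_, sum_smul_mem_convexHull_cayley (w := fun _ => 1 / (k : ℝ))
      (fun _ => by positivity) (by simp [hk0]) hp, ((1 / (k : ℝ)) • ∑ i, c i, 0), ⟨?_, ?_, rfl⟩, ?_⟩
    · simp [Prod.fst_sum, fun i => (hc i).1]
    · simp only [Prod.smul_snd, Prod.snd_sum, smul_eq_mul]
      exact mul_nonpos_of_nonneg_of_nonpos (by positivity)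
        (Finset.sum_nonpos fun i _ => (hc i).2)
    · refine Prod.ext ?_ (add_zero _)
      change ∑ i, (1 / (k : ℝ)) • p i + (1 / (k : ℝ)) • ∑ i, c i = (1 / (k : ℝ)) • ∑ i, g i
      rw [← Finset.smul_sum, ← smul_add, ← Finset.sum_add_distrib]
      exact congrArg _ (Finset.sum_congr rfl fun i _ => hpc i)
  · rintro ⟨⟨x, w⟩, hx, ⟨c, d⟩, ⟨hc1, hc2, hd⟩, heq⟩
    obtain ⟨r, hr, hrx⟩ := exists_sum_of_mem_convexHull_cayley hS hx
    simp only [Prod.mk_add_mk, Prod.mk.injEq] at heq hd hrx hr hc1 hc2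
    obtain ⟨rfl, hw⟩ := heq
    rw [hd, add_zero] at hw
    subst hw
    choose p hp hpr using hr
    simp only at hpr
    refine ⟨∑ i, (p i + c), (Set.mem_fintype_sum _ _).2
      ⟨_, fun i => Set.add_mem_add (hp i) ⟨hc1, hc2⟩, rfl⟩, ?_⟩
    simp only [Finset.sum_add_distrib, smul_add, Finset.smul_sum, hpr, hrx]
    simp [← Nat.cast_smul_eq_nsmul ℝ, smul_smul, hk0, Finset.sum_const]
end

section
/- Let A_i : Fin m_i → ℤ^n for i = 1, …, n, with each m_i ≥ 1. Then for Lebesgue-almost every ω = (ω_1, …, ω_n) ∈ ℝ^{m_1} × ⋯ × ℝ^{m_n}, the intersection T(A_1, ω_1) ∩ ⋯ ∩ T(A_n, ω_n) of the n tropical hypersurfaces is a finite subset of ℝ^n whose cardinality is at most MV(conv(range A_1), …, conv(range A_n)). -/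
open Pointwise MeasureTheory

/-- The dot product on `ℝⁿ`. -/
noncomputable def dotp (n : ℕ) (x y : Fin n → ℝ) : ℝ := ∑ l, x l * y l

/-- The tropical hypersurface of the configuration `A` with coefficients `ω`:
the set of points where the maximum of `j ↦ ω j + ⟪A j, x⟫` is attained at
at least two distinct indices. -/
def tropH (n m : ℕ) (A : Fin m → Fin n → ℝ) (ω : Fin m → ℝ) : Set (Fin n → ℝ) :=
  {x | ∃ j k : Fin m, j ≠ k ∧
    (∀ l, ω l + dotp n (A l) x ≤ ω j + dotp n (A j) x) ∧
    ω j + dotp n (A j) x = ω k + dotp n (A k) x}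

/-- The mixed volume of `n` compact convex bodies in `ℝⁿ`, via
inclusion–exclusion on volumes of Minkowski sums. -/
noncomputable def mixedVol (n : ℕ) (C : Fin n → Set (Fin n → ℝ)) : ℝ :=
  ∑ S : Finset (Fin n), (-1 : ℝ) ^ (n - S.card) * (volume (∑ i ∈ S, C i)).toReal

section

open Set Filter Topology

/-! ### The dot product -/

lemma dotp_add_left {n : ℕ} (x y z : Fin n → ℝ) : dotp n (x + y) z = dotp n x z + dotp n y z :=
  add_dotProduct x y z

lemma dotp_add_right {n : ℕ} (x y z : Fin n → ℝ) : dotp n x (y + z) = dotp n x y + dotp n x z :=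
  dotProduct_add x y z

lemma dotp_sub_left {n : ℕ} (x y z : Fin n → ℝ) : dotp n (x - y) z = dotp n x z - dotp n y z :=
  sub_dotProduct x y z

lemma dotp_sub_right {n : ℕ} (x y z : Fin n → ℝ) : dotp n x (y - z) = dotp n x y - dotp n x z :=
  dotProduct_sub x y z

lemma dotp_smul_left {n : ℕ} (c : ℝ) (x y : Fin n → ℝ) : dotp n (c • x) y = c * dotp n x y :=
  smul_dotProduct c x y

lemma dotp_smul_right {n : ℕ} (c : ℝ) (x y : Fin n → ℝ) : dotp n x (c • y) = c * dotp n x y :=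
  dotProduct_smul c x y

lemma dotp_sum_left {n : ℕ} {ι : Type*} (s : Finset ι) (f : ι → Fin n → ℝ) (y : Fin n → ℝ) :
    dotp n (∑ i ∈ s, f i) y = ∑ i ∈ s, dotp n (f i) y :=
  sum_dotProduct s f y

lemma continuous_dotp {n : ℕ} (a : Fin n → ℝ) : Continuous (dotp n a) := by
  unfold dotp; fun_prop

/-- `y ↦ dotp n y u` as a linear map. -/
noncomputable def dotpLin (n : ℕ) (u : Fin n → ℝ) : (Fin n → ℝ) →ₗ[ℝ] ℝ where
  toFun y := dotp n y u
  map_add' x y := dotp_add_left x y u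
  map_smul' c x := dotp_smul_left c x u

lemma exists_dotp_eq {n : ℕ} (f : (Fin n → ℝ) →L[ℝ] ℝ) : ∃ u, ∀ y, f y = dotp n y u := by
  refine ⟨fun l => f (Pi.single l 1), fun y => ?_⟩
  conv_lhs => rw [← Finset.univ_sum_single y]
  rw [map_sum]
  refine Finset.sum_congr rfl fun l _ => ?_
  rw [← smul_eq_mul, ← map_smul]
  congr 1
  rw [← Pi.single_smul, smul_eq_mul, mul_one]

lemma dotp_self_pos {n : ℕ} {u : Fin n → ℝ} (hu : u ≠ 0) : 0 < dotp n u u := by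
  have h : 0 ≤ dotp n u u := Finset.sum_nonneg fun l _ => mul_self_nonneg _
  exact h.lt_of_ne fun h0 => hu (dotProduct_self_eq_zero.1 h0.symm)

lemma measure_ker_eq_zero {E : Type*} [NormedAddCommGroup E] [NormedSpace ℝ E]
    [FiniteDimensional ℝ E] [MeasurableSpace E] [BorelSpace E] (μ : Measure E)
    [μ.IsAddHaarMeasure] (L : E →ₗ[ℝ] ℝ) {w : E} (hw : L w ≠ 0) : μ {x | L x = 0} = 0 :=
  Measure.addHaar_submodule μ (LinearMap.ker L)
    fun htop => hw (LinearMap.congr_fun (LinearMap.ker_eq_top.1 htop) w)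

lemma volume_hyperplane {n : ℕ} {u : Fin n → ℝ} (hu : u ≠ 0) (c : ℝ) :
    volume {y : Fin n → ℝ | dotp n y u = c} = 0 := by
  by_cases hne : ∃ y₀, dotp n y₀ u = c
  · obtain ⟨y₀, rfl⟩ := hne
    have h := measure_ker_eq_zero (volume : Measure (Fin n → ℝ)) (dotpLin n u) (dotp_self_pos hu).ne'
    have heq : {y : Fin n → ℝ | dotp n y u = dotp n y₀ u} =
        (fun y => y + -y₀) ⁻¹' {y | dotpLin n u y = 0} := by
      ext y
      simp [dotpLin, ← sub_eq_add_neg, dotp_sub_left, sub_eq_zero]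
    rw [heq, measure_preimage_add_right, h]
  · push Not at hne
    simp [hne]

/-! ### Tropical polynomials, active monomials and faces -/

section Tropical

variable {n m : ℕ}

/-- The value at `x` of the tropical polynomial with exponents `A` and coefficients `ω`. -/
noncomputable def tropVal (A : Fin m → Fin n → ℝ) (ω : Fin m → ℝ) (x : Fin n → ℝ) : ℝ :=
  ⨆ j, (ω j + dotp n (A j) x)

/-- The indices of the monomials attaining the maximum at `x`. -/
def activeSet (A : Fin m → Fin n → ℝ) (ω : Fin m → ℝ) (x : Fin n → ℝ) : Set (Fin m) :=
  {j | ω j + dotp n (A j) x = tropVal A ω x}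

/-- The cell dual to `x`: the convex hull of the exponents active at `x`. -/
def dualCell (A : Fin m → Fin n → ℝ) (ω : Fin m → ℝ) (x : Fin n → ℝ) : Set (Fin n → ℝ) :=
  convexHull ℝ (A '' activeSet A ω x)

variable (A : Fin m → Fin n → ℝ) (ω : Fin m → ℝ)

lemma le_tropVal (x : Fin n → ℝ) (j : Fin m) : ω j + dotp n (A j) x ≤ tropVal A ω x :=
  le_ciSup (f := fun j => ω j + dotp n (A j) x) (Set.finite_range _).bddAbove j

lemma activeSet_nonempty [Nonempty (Fin m)] (x : Fin n → ℝ) : (activeSet A ω x).Nonempty :=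
  exists_eq_ciSup_of_finite (f := fun j => ω j + dotp n (A j) x)

lemma mem_activeSet_iff [Nonempty (Fin m)] (x : Fin n → ℝ) (j : Fin m) :
    j ∈ activeSet A ω x ↔ ∀ l, ω l + dotp n (A l) x ≤ ω j + dotp n (A j) x := by
  constructor
  · intro h l
    rw [show ω j + dotp n (A j) x = tropVal A ω x from h]
    exact le_tropVal A ω x l
  · exact fun h => le_antisymm (le_tropVal A ω x j) (ciSup_le h)

lemma mem_tropH_iff [Nonempty (Fin m)] (x : Fin n → ℝ) :
    x ∈ tropH n m A ω ↔ ∃ j ∈ activeSet A ω x, ∃ k ∈ activeSet A ω x, j ≠ k := by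
  constructor
  · rintro ⟨j, k, hjk, hmax, heq⟩
    exact ⟨j, (mem_activeSet_iff A ω x j).2 hmax, k,
      (mem_activeSet_iff A ω x k).2 fun l => heq ▸ hmax l, hjk⟩
  · rintro ⟨j, hj, k, hk, hjk⟩
    exact ⟨j, k, hjk, (mem_activeSet_iff A ω x j).1 hj, Eq.trans hj (Eq.symm hk)⟩

lemma continuous_tropVal [Nonempty (Fin m)] : Continuous (tropVal A ω) := by
  have h : tropVal A ω =
      fun x => Finset.univ.sup' Finset.univ_nonempty fun j => ω j + dotp n (A j) x := by
    ext x
    exact (Finset.sup'_univ_eq_ciSup _).symm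
  rw [h]
  exact Continuous.finset_sup'_apply _ fun j _ => continuous_const.add (continuous_dotp _)

lemma convex_dotp_le (u : Fin n → ℝ) (c : ℝ) : Convex ℝ {q | dotp n q u ≤ c} :=
  convex_halfSpace_le (dotpLin n u).isLinear c

lemma dualCell_subset (x : Fin n → ℝ) : dualCell A ω x ⊆ convexHull ℝ (range A) :=
  convexHull_mono (image_subset_range _ _)

/-- Elements of the dual cell are subgradients. -/
lemma dotp_sub_le_of_mem_dualCell {x q : Fin n → ℝ} (hq : q ∈ dualCell A ω x) (y : Fin n → ℝ) :
    dotp n q (y - x) ≤ tropVal A ω y - tropVal A ω x := by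
  refine convexHull_min ?_ (convex_dotp_le (y - x) (tropVal A ω y - tropVal A ω x)) hq
  rintro _ ⟨j, hj, rfl⟩
  have h1 := le_tropVal A ω y j
  have h2 : ω j + dotp n (A j) x = tropVal A ω x := hj
  show dotp n (A j) (y - x) ≤ _
  rw [dotp_sub_right]
  linarith

lemma exists_dotp_le_tropVal [Nonempty (Fin m)] :
    ∃ c : ℝ, ∀ q ∈ convexHull ℝ (range A), ∀ x, dotp n q x ≤ tropVal A ω x + c := by
  obtain ⟨j₀, hj₀⟩ := Finite.exists_min ω
  refine ⟨-ω j₀, fun q hq x => ?_⟩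
  refine convexHull_min ?_ (convex_dotp_le x (tropVal A ω x + -ω j₀)) hq
  rintro _ ⟨j, rfl⟩
  have h1 := le_tropVal A ω x j
  have h2 := hj₀ j
  show dotp n (A j) x ≤ _
  linarith

/-- The one-sided directional derivative of a tropical polynomial is attained in the dual cell. -/
lemma exists_mem_dualCell_directional [Nonempty (Fin m)] (x u : Fin n → ℝ) :
    ∃ q ∈ dualCell A ω x, ∀ᶠ t : ℝ in 𝓝[>] 0,
      tropVal A ω (x + t • u) ≤ tropVal A ω x + t * dotp n q u := by
  obtain ⟨j, hj, hmax⟩ := Set.exists_max_image (activeSet A ω x) (fun j => dotp n (A j) u)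
    (Set.toFinite _) (activeSet_nonempty A ω x)
  refine ⟨A j, subset_convexHull ℝ _ (mem_image_of_mem _ hj), ?_⟩
  have key : ∀ l, ∀ᶠ t : ℝ in 𝓝[>] 0,
      ω l + dotp n (A l) (x + t • u) ≤ tropVal A ω x + t * dotp n (A j) u := by
    intro l
    by_cases hl : l ∈ activeSet A ω x
    · filter_upwards [self_mem_nhdsWithin] with t ht
      have h1 : ω l + dotp n (A l) x = tropVal A ω x := hl
      have h2 := mul_le_mul_of_nonneg_left (hmax l hl) (le_of_lt (show (0 : ℝ) < t from ht))
      rw [dotp_add_right, dotp_smul_right]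
      linarith
    · have hlt : ω l + dotp n (A l) x < tropVal A ω x := lt_of_le_of_ne (le_tropVal A ω x l) hl
      have h1 : Continuous fun t : ℝ => ω l + (dotp n (A l) x + t * dotp n (A l) u) := by fun_prop
      have h2 : Continuous fun t : ℝ => tropVal A ω x + t * dotp n (A j) u := by fun_prop
      have h3 := (isOpen_lt h1 h2).mem_nhds (x := (0 : ℝ)) (by simpa using hlt)
      filter_upwards [mem_nhdsWithin_of_mem_nhds h3] with t ht
      rw [dotp_add_right, dotp_smul_right]
      exact le_of_lt ht
  filter_upwards [eventually_all.2 key] with t ht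
  exact ciSup_le ht

end Tropical

/-! ### Decomposing the Minkowski sum of Newton polytopes into dual cells -/

lemma isCompact_sum_sets {n : ℕ} {ι : Type*} (S : Finset ι) {C : ι → Set (Fin n → ℝ)}
    (h : ∀ i, IsCompact (C i)) : IsCompact (∑ i ∈ S, C i) := by
  classical
  induction S using Finset.induction_on with
  | empty => simp
  | insert i S hi ih => rw [Finset.sum_insert hi]; exact (h i).add ih

lemma mul_norm_le_of_dotp_le {n : ℕ} {x : Fin n → ℝ} {ε B : ℝ} (hε : 0 < ε)
    (h : ∀ v : Fin n → ℝ, ‖v‖ ≤ ε → dotp n v x ≤ B) : ε * ‖x‖ ≤ B := by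
  have hB : 0 ≤ B := by
    have h0 := h 0 (by simp [hε.le])
    rwa [show dotp n 0 x = 0 from zero_dotProduct x] at h0
  rw [← le_div_iff₀' hε, pi_norm_le_iff_of_nonneg (by positivity)]
  intro l
  rw [le_div_iff₀' hε, Real.norm_eq_abs]
  have h1 := h (Pi.single l ε) (by rw [Pi.norm_single, Real.norm_eq_abs, abs_of_pos hε])
  have h2 := h (Pi.single l (-ε)) (by rw [Pi.norm_single, Real.norm_eq_abs, abs_neg, abs_of_pos hε])
  have e : ∀ c, dotp n (Pi.single l c) x = c * x l := fun c => single_dotProduct x c l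
  rw [e] at h1 h2
  rcases abs_cases (x l) with ⟨hx, _⟩ | ⟨hx, _⟩ <;> rw [hx] <;> linarith

section MinkowskiSum

variable {n : ℕ} {ι : Type*} {m : ι → ℕ}
  (A : ∀ i, Fin (m i) → Fin n → ℝ) (ω : ∀ i, Fin (m i) → ℝ) (S : Finset ι)

lemma isCompact_sum_dualCell (x : Fin n → ℝ) :
    IsCompact (∑ i ∈ S, dualCell (A i) (ω i) x) :=
  isCompact_sum_sets S fun _ => (Set.toFinite _).isCompact_convexHull ℝ

lemma sum_dualCell_subset (x : Fin n → ℝ) :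
    ∑ i ∈ S, dualCell (A i) (ω i) x ⊆ ∑ i ∈ S, convexHull ℝ (range (A i)) :=
  Set.finsetSum_subset_finsetSum _ _ _ fun i _ => dualCell_subset (A i) (ω i) x

lemma dotp_sub_le_of_mem_sum_dualCell {x q : Fin n → ℝ}
    (hq : q ∈ ∑ i ∈ S, dualCell (A i) (ω i) x) (y : Fin n → ℝ) :
    dotp n q (y - x) ≤ ∑ i ∈ S, tropVal (A i) (ω i) y - ∑ i ∈ S, tropVal (A i) (ω i) x := by
  obtain ⟨g, hg, rfl⟩ := Set.mem_finsetSum _ _ _ |>.1 hq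
  rw [dotp_sum_left, ← Finset.sum_sub_distrib]
  exact Finset.sum_le_sum fun i hi => dotp_sub_le_of_mem_dualCell _ _ (hg hi) y

/-- Cells dual to distinct points overlap in a null set. -/
lemma volume_inter_sum_dualCell {x y : Fin n → ℝ} (hxy : x ≠ y) :
    volume ((∑ i ∈ S, dualCell (A i) (ω i) x) ∩ ∑ i ∈ S, dualCell (A i) (ω i) y) = 0 := by
  refine measure_mono_null ?_ (volume_hyperplane (sub_ne_zero.2 hxy.symm)
    (∑ i ∈ S, tropVal (A i) (ω i) y - ∑ i ∈ S, tropVal (A i) (ω i) x))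
  rintro q ⟨hx, hy⟩
  have h1 := dotp_sub_le_of_mem_sum_dualCell A ω S hx y
  have h2 := dotp_sub_le_of_mem_sum_dualCell A ω S hy x
  rw [dotp_sub_right] at h1 h2
  rw [Set.mem_ofPred_eq, dotp_sub_right]
  linarith

lemma finite_range_sum_dualCell [Finite ι] :
    (range fun x => ∑ i ∈ S, dualCell (A i) (ω i) x).Finite :=
  (Set.finite_range fun J : ∀ i, Set (Fin (m i)) => ∑ i ∈ S, convexHull ℝ (A i '' J i)).subset
    (by rintro _ ⟨x, rfl⟩; exact ⟨fun i => activeSet (A i) (ω i) x, rfl⟩)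

lemma finite_volume_sum_dualCell_ne_zero [Finite ι] :
    {x | volume (∑ i ∈ S, dualCell (A i) (ω i) x) ≠ 0}.Finite := by
  refine Set.Finite.of_finite_image
    ((finite_range_sum_dualCell A ω S).subset (image_subset_range _ _)) ?_
  intro x hx y _ hxy
  by_contra hne
  refine hx ?_
  have h := volume_inter_sum_dualCell A ω S hne
  simp only at hxy
  rwa [← hxy, inter_self] at h

variable [∀ i, Nonempty (Fin (m i))]

/-- Every interior point of the Minkowski sum of the Newton polytopes lies in a dual cell. -/
lemma exists_mem_sum_dualCell {p : Fin n → ℝ}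
    (hp : p ∈ interior (∑ i ∈ S, convexHull ℝ (range (A i)))) :
    ∃ x, p ∈ ∑ i ∈ S, dualCell (A i) (ω i) x := by
  set h : (Fin n → ℝ) → ℝ := fun x => ∑ i ∈ S, tropVal (A i) (ω i) x - dotp n p x with h_def
  have hcont : Continuous h :=
    (continuous_finsetSum _ fun i _ => continuous_tropVal _ _).sub (continuous_dotp p)
  choose c hc using fun i => exists_dotp_le_tropVal (A i) (ω i)
  have hlow : ∀ q ∈ ∑ i ∈ S, convexHull ℝ (range (A i)), ∀ x,
      dotp n q x ≤ ∑ i ∈ S, tropVal (A i) (ω i) x + ∑ i ∈ S, c i := by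
    intro q hq x
    obtain ⟨g, hg, rfl⟩ := Set.mem_finsetSum _ _ _ |>.1 hq
    rw [dotp_sum_left, ← Finset.sum_add_distrib]
    exact Finset.sum_le_sum fun i hi => hc i _ (hg hi) x
  obtain ⟨ε, hε, hball⟩ := Metric.nhds_basis_closedBall.mem_iff.1 (mem_interior_iff_mem_nhds.1 hp)
  have hcoer : ∀ x, ε * ‖x‖ ≤ h x + ∑ i ∈ S, c i := fun x =>
    mul_norm_le_of_dotp_le hε fun v hv => by
      have := hlow (p + v) (hball (by simpa [dist_eq_norm] using hv)) x
      rw [dotp_add_left] at this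
      simp only [h_def]
      linarith
  have htend : Tendsto h (cocompact _) atTop := by
    refine tendsto_atTop_mono (fun x => sub_le_iff_le_add.2 (hcoer x)) ?_
    exact tendsto_atTop_add_const_right _ _
      ((tendsto_norm_cocompact_atTop (E := Fin n → ℝ)).const_mul_atTop hε)
  obtain ⟨x, hx⟩ := hcont.exists_forall_le htend
  refine ⟨x, by_contra fun hpx => ?_⟩
  obtain ⟨f, s, hf, hs⟩ := geometric_hahn_banach_closed_point
    (convex_sum (𝕜 := ℝ) (s := S) _ fun i _ => convex_convexHull ℝ (A i '' activeSet (A i) (ω i) x))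
    (isCompact_sum_dualCell A ω S x).isClosed hpx
  obtain ⟨u, hu⟩ := exists_dotp_eq f
  choose q hq hdir using fun i => exists_mem_dualCell_directional (A i) (ω i) x u
  have hlt := (hf _ (Set.finsetSum_mem_finsetSum _ _ _ fun i (_ : i ∈ S) => hq i)).trans hs
  rw [hu, hu, dotp_sum_left] at hlt
  obtain ⟨t, ht, ht0⟩ :=
    (((Finset.eventually_all S).2 fun i _ => hdir i).and self_mem_nhdsWithin).exists
  have h1 := hx (x + t • u)
  have h2 := Finset.sum_le_sum ht
  rw [Finset.sum_add_distrib, ← Finset.mul_sum] at h2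
  simp only [h_def, dotp_add_right, dotp_smul_right] at h1
  have h3 := mul_lt_mul_of_pos_left hlt (show (0 : ℝ) < t from ht0)
  linarith

/-- The volume of a Minkowski sum of Newton polytopes is the sum of the volumes of its
full-dimensional dual cells. -/
lemma volume_sum_newton [Finite ι] (X : Finset (Fin n → ℝ))
    (hX : ∀ x ∉ X, volume (∑ i ∈ S, dualCell (A i) (ω i) x) = 0) :
    volume (∑ i ∈ S, convexHull ℝ (range (A i))) =
      ∑ x ∈ X, volume (∑ i ∈ S, dualCell (A i) (ω i) x) := by
  rw [← measure_biUnion_finset₀ (fun x _ y _ hxy => volume_inter_sum_dualCell A ω S hxy)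
    fun x _ => (isCompact_sum_dualCell A ω S x).isClosed.measurableSet.nullMeasurableSet]
  have hsub : ⋃ x ∈ X, ∑ i ∈ S, dualCell (A i) (ω i) x ⊆ ∑ i ∈ S, convexHull ℝ (range (A i)) :=
    iUnion₂_subset fun x _ => sum_dualCell_subset A ω S x
  refine le_antisymm ?_ (measure_mono hsub)
  set Z := ⋃₀ ((fun x => ∑ i ∈ S, dualCell (A i) (ω i) x) '' {x | x ∉ X}) with hZ
  have hZ0 : volume Z = 0 := by
    refine (measure_sUnion_null_iff
      ((finite_range_sum_dualCell A ω S).subset (image_subset_range _ _)).countable).2 ?_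
    rintro _ ⟨x, hx, rfl⟩
    exact hX x hx
  have hfr : volume (frontier (∑ i ∈ S, convexHull ℝ (range (A i)))) = 0 :=
    (convex_sum (𝕜 := ℝ) _ fun i _ => convex_convexHull ℝ _).addHaar_frontier _
  have hcov : ∑ i ∈ S, convexHull ℝ (range (A i)) ⊆
      (⋃ x ∈ X, ∑ i ∈ S, dualCell (A i) (ω i) x) ∪
        (Z ∪ frontier (∑ i ∈ S, convexHull ℝ (range (A i)))) := by
    intro p hp
    by_cases hpi : p ∈ interior (∑ i ∈ S, convexHull ℝ (range (A i)))
    · obtain ⟨x, hx⟩ := exists_mem_sum_dualCell A ω S hpi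
      by_cases hxX : x ∈ X
      · exact Or.inl (mem_iUnion₂.2 ⟨x, hxX, hx⟩)
      · exact Or.inr (Or.inl ⟨_, ⟨x, hxX, rfl⟩, hx⟩)
    · exact Or.inr (Or.inr ⟨subset_closure hp, hpi⟩)
  refine (measure_mono hcov).trans ((measure_union_le _ _).trans ?_)
  rw [measure_union_null hZ0 hfr, add_zero]

end MinkowskiSum

/-- The mixed volume of the Newton polytopes is the sum of the mixed volumes of the dual cells. -/
lemma mixedVol_newton_eq_sum {n : ℕ} {m : Fin n → ℕ} [∀ i, Nonempty (Fin (m i))]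
    (A : ∀ i, Fin (m i) → Fin n → ℝ) (ω : ∀ i, Fin (m i) → ℝ) :
    ∃ X : Finset (Fin n → ℝ),
      (∀ x ∉ X, mixedVol n (fun i => dualCell (A i) (ω i) x) = 0) ∧
      mixedVol n (fun i => convexHull ℝ (range (A i))) =
        ∑ x ∈ X, mixedVol n (fun i => dualCell (A i) (ω i) x) := by
  have hfin := Set.finite_iUnion fun S : Finset (Fin n) => finite_volume_sum_dualCell_ne_zero A ω S
  have hX : ∀ x ∉ hfin.toFinset, ∀ S : Finset (Fin n),
      volume (∑ i ∈ S, dualCell (A i) (ω i) x) = 0 := by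
    intro x hx S
    by_contra h
    exact hx (hfin.mem_toFinset.2 (mem_iUnion.2 ⟨S, h⟩))
  refine ⟨hfin.toFinset, fun x hx => ?_, ?_⟩
  · simp [mixedVol, hX x hx]
  · simp only [mixedVol]
    rw [Finset.sum_comm]
    refine Finset.sum_congr rfl fun S _ => ?_
    rw [← Finset.mul_sum, volume_sum_newton A ω S hfin.toFinset fun x hx => hX x hx S,
      ENNReal.toReal_sum fun x _ => (isCompact_sum_dualCell A ω S x).measure_lt_top.ne]

/-! ### Mixed volumes of points and of segments -/

lemma neg_one_pow_sub_succ {n k : ℕ} (h : k + 1 ≤ n) :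
    (-1 : ℝ) ^ (n - k) = -(-1) ^ (n - (k + 1)) := by
  rw [show n - k = n - (k + 1) + 1 by omega, pow_succ]
  ring

lemma mixedVol_eq_zero_of_singleton {n : ℕ} (C : Fin n → Set (Fin n → ℝ)) {i : Fin n}
    {a : Fin n → ℝ} (h : C i = {a}) : mixedVol n C = 0 := by
  have huniv : (Finset.univ : Finset (Finset (Fin n))) =
      (insert i (Finset.univ.erase i)).powerset := by
    rw [Finset.insert_erase (Finset.mem_univ i), Finset.powerset_univ]
  rw [mixedVol, huniv, Finset.sum_powerset_insert (Finset.notMem_erase i _),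
    ← Finset.sum_add_distrib]
  refine Finset.sum_eq_zero fun S hS => ?_
  have hi : i ∉ S := fun hi => Finset.notMem_erase i _ (Finset.mem_powerset.1 hS hi)
  have hcard : S.card + 1 ≤ n := by
    rw [← Finset.card_insert_of_notMem hi]
    exact (Finset.card_le_univ _).trans_eq (Fintype.card_fin n)
  rw [Finset.sum_insert hi, h, Finset.card_insert_of_notMem hi, neg_one_pow_sub_succ hcard,
    Set.singleton_add, Set.image_add_left, measure_preimage_add]
  ring

lemma volume_parallelepiped {n : ℕ} (v : Fin n → Fin n → ℝ) :
    volume (parallelepiped v) = ENNReal.ofReal |(Matrix.of v).det| := by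
  have h := Measure.addHaar_parallelepiped (Pi.basisFun ℝ (Fin n)) v
  rwa [Module.Basis.addHaar, Module.Basis.parallelepiped_basisFun, addHaarMeasure_eq_volume_pi,
    Pi.basisFun_det] at h

lemma volume_sum_segment {n : ℕ} (a b : Fin n → Fin n → ℝ) (S : Finset (Fin n)) :
    volume (∑ i ∈ S, segment ℝ (a i) (b i)) =
      ENNReal.ofReal |(Matrix.of fun i => if i ∈ S then b i - a i else 0).det| := by
  have hseg : ∀ i, segment ℝ (a i) (b i) = {a i} + segment ℝ 0 (b i - a i) := fun i => by
    rw [Set.singleton_add, segment_translate_image, add_zero, add_sub_cancel]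
  have hpar : ∑ i ∈ S, segment ℝ 0 (b i - a i) =
      parallelepiped fun i => if i ∈ S then b i - a i else 0 := by
    rw [parallelepiped_eq_sum_segment, ← Finset.sum_subset (Finset.subset_univ S)]
    · exact Finset.sum_congr rfl fun i hi => by rw [if_pos hi]
    · intro i _ hi
      rw [if_neg hi, segment_same]
      rfl
  rw [Finset.sum_congr rfl fun i _ => hseg i, Finset.sum_add_distrib, Set.finsetSum_singleton,
    Set.singleton_add, Set.image_add_left, measure_preimage_add, hpar, volume_parallelepiped]

lemma mixedVol_segment {n : ℕ} (a b : Fin n → Fin n → ℝ) :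
    mixedVol n (fun i => segment ℝ (a i) (b i)) = |(Matrix.of fun i => b i - a i).det| := by
  rw [mixedVol, Finset.sum_eq_single Finset.univ]
  · simp [volume_sum_segment]
  · intro S _ hS
    obtain ⟨i, hi⟩ : ∃ i, i ∉ S := by simpa [Finset.eq_univ_iff_forall] using hS
    rw [volume_sum_segment, Matrix.det_eq_zero_of_row_eq_zero i (fun l => by simp [hi])]
    simp
  · simp

/-! ### Transversality for generic coefficients -/

/-- For almost every `ω`, the exponent differences of monomials that agree at a common point are
linearly independent. -/
lemma ae_linearIndepOn {n : ℕ} {m : Fin n → ℕ} (A : ∀ i, Fin (m i) → Fin n → ℝ) :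
    ∀ᵐ ω ∂(volume : Measure (∀ i : Fin n, Fin (m i) → ℝ)),
      ∀ (j : ∀ i, Fin (m i)) (K : Set (Σ i, Fin (m i))), (∀ p ∈ K, p.2 ≠ j p.1) →
        ∀ x, (∀ p ∈ K, ω p.1 p.2 + dotp n (A p.1 p.2) x =
          ω p.1 (j p.1) + dotp n (A p.1 (j p.1)) x) →
        LinearIndepOn ℝ (fun p : Σ i, Fin (m i) => A p.1 p.2 - A p.1 (j p.1)) K := by
  refine ae_all_iff.2 fun j => ae_all_iff.2 fun K => ?_
  by_cases hind : LinearIndepOn ℝ (fun p : Σ i, Fin (m i) => A p.1 p.2 - A p.1 (j p.1)) K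
  · exact ae_of_all _ fun _ _ _ _ => hind
  by_cases hK : ∀ p ∈ K, p.2 ≠ j p.1
  swap
  · exact ae_of_all _ fun _ h => absurd h hK
  have : Fintype K := Fintype.ofFinite K
  obtain ⟨g, hg, p₀, hp₀⟩ := Fintype.not_linearIndependent_iff.1 hind
  let e : ∀ i, Fin (m i) → (∀ i : Fin n, Fin (m i) → ℝ) →ₗ[ℝ] ℝ := fun i l =>
    LinearMap.proj l ∘ₗ LinearMap.proj i
  let L : (∀ i : Fin n, Fin (m i) → ℝ) →ₗ[ℝ] ℝ :=
    ∑ p : K, g p • (e p.1.1 p.1.2 - e p.1.1 (j p.1.1))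
  have hL : ∀ ω, L ω = ∑ p : K, g p * (ω p.1.1 p.1.2 - ω p.1.1 (j p.1.1)) := fun ω => by
    simp [L, e]
  have hne : L (Pi.single p₀.1.1 (Pi.single p₀.1.2 1)) ≠ 0 := by
    rw [hL, Finset.sum_eq_single p₀]
    · simpa [Pi.single_apply, (hK p₀ p₀.2).symm] using hp₀
    · rintro ⟨⟨i, l⟩, hp⟩ _ hpp
      obtain ⟨⟨i₀, l₀⟩, hp₀K⟩ := p₀
      by_cases hi : i = i₀
      · subst hi
        have h1 : l ≠ l₀ := fun h => hpp (by subst h; rfl)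
        have h2 : j i ≠ l₀ := (hK _ hp₀K).symm
        simp [h1, h2]
      · simp [hi]
    · simp
  refine measure_mono_null ?_ (measure_ker_eq_zero volume L hne)
  intro ω hω
  by_contra hLω
  refine hω fun _ x hx => absurd ?_ hLω
  have h0 : ∑ p : K, g p * dotp n (A p.1.1 p.1.2 - A p.1.1 (j p.1.1)) x = 0 := by
    simp_rw [← dotp_smul_left]
    rw [← dotp_sum_left, hg]
    simp [dotp]
  show L ω = 0
  rw [hL, ← neg_eq_zero, ← h0, ← Finset.sum_neg_distrib]
  refine Finset.sum_congr rfl fun p _ => ?_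
  have := hx p p.2
  rw [dotp_sub_left, ← mul_neg]
  congr 1
  linarith

/-- At a generic intersection point each tropical polynomial has exactly two active monomials, and
the differences of their exponents are linearly independent. -/
lemma activeSet_eq_pair_and_linearIndependent {n : ℕ} {m : Fin n → ℕ}
    [∀ i, Nonempty (Fin (m i))] {A : ∀ i, Fin (m i) → Fin n → ℝ} {ω : ∀ i, Fin (m i) → ℝ}
    (hω : ∀ (j : ∀ i, Fin (m i)) (K : Set (Σ i, Fin (m i))), (∀ p ∈ K, p.2 ≠ j p.1) →
        ∀ x, (∀ p ∈ K, ω p.1 p.2 + dotp n (A p.1 p.2) x =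
          ω p.1 (j p.1) + dotp n (A p.1 (j p.1)) x) →
        LinearIndepOn ℝ (fun p : Σ i, Fin (m i) => A p.1 p.2 - A p.1 (j p.1)) K)
    {x : Fin n → ℝ} (hx : ∀ i, x ∈ tropH n (m i) (A i) (ω i)) :
    ∃ j k : ∀ i, Fin (m i), (∀ i, activeSet (A i) (ω i) x = {j i, k i}) ∧
      LinearIndependent ℝ fun i => A i (k i) - A i (j i) := by
  choose j hj k hk hjk using fun i => (mem_tropH_iff (A i) (ω i) x).1 (hx i)
  set K : Set (Σ i, Fin (m i)) := {p | p.2 ∈ activeSet (A p.1) (ω p.1) x ∧ p.2 ≠ j p.1}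
  have hind := hω j K (fun p hp => hp.2) x fun p hp => Eq.trans hp.1 (Eq.symm (hj p.1))
  let f : Fin n → K := fun i => ⟨⟨i, k i⟩, hk i, (hjk i).symm⟩
  have hf : Function.Injective f := fun i i' h => congrArg (fun p : K => p.1.1) h
  have : Fintype K := Fintype.ofFinite K
  have hcard : Fintype.card K ≤ Fintype.card (Fin n) := by
    simpa using LinearIndependent.fintype_card_le_finrank hind
  have hsurj : Function.Surjective f :=
    (Fintype.bijective_iff_injective_and_card f).2
      ⟨hf, le_antisymm (Fintype.card_le_of_injective f hf) hcard⟩ |>.2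
  refine ⟨j, k, fun i => ?_, LinearIndependent.comp hind f hf⟩
  refine Set.Subset.antisymm (fun l hl => ?_) ?_
  · by_cases hlj : l = j i
    · exact Or.inl hlj
    · obtain ⟨i', hi'⟩ := hsurj ⟨⟨i, l⟩, hl, hlj⟩
      have h := congrArg Subtype.val hi'
      simp only [f] at h
      cases h
      exact Or.inr rfl
  · rintro l (rfl | rfl)
    exacts [hj i, hk i]

lemma one_le_abs_det_of_linearIndependent {n : ℕ} (v : Fin n → Fin n → ℤ)
    (hv : LinearIndependent ℝ fun i => fun l => (v i l : ℝ)) :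
    1 ≤ |(Matrix.of fun i => fun l => (v i l : ℝ)).det| := by
  have hne : (Matrix.of fun i => fun l => (v i l : ℝ)).det ≠ 0 :=
    ((Matrix.isUnit_iff_isUnit_det _).1 (Matrix.linearIndependent_rows_iff_isUnit.1 hv)).ne_zero
  have hcast : (Matrix.of fun i => fun l => (v i l : ℝ)).det = ((Matrix.of v).det : ℤ) :=
    (Int.cast_det (R := ℝ) (Matrix.of v)).symm
  rw [hcast] at hne ⊢
  exact_mod_cast Int.one_le_abs (by exact_mod_cast hne)

lemma mixedVol_dualCell_eq_zero {n : ℕ} {m : Fin n → ℕ} [∀ i, Nonempty (Fin (m i))]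
    {A : ∀ i, Fin (m i) → Fin n → ℝ} {ω : ∀ i, Fin (m i) → ℝ} {x : Fin n → ℝ} {i : Fin n}
    (hx : x ∉ tropH n (m i) (A i) (ω i)) :
    mixedVol n (fun i => dualCell (A i) (ω i) x) = 0 := by
  obtain ⟨j, hj⟩ := activeSet_nonempty (A i) (ω i) x
  refine mixedVol_eq_zero_of_singleton _ (i := i) (a := A i j) ?_
  have hact : activeSet (A i) (ω i) x = {j} := by
    refine Set.eq_singleton_iff_unique_mem.2 ⟨hj, fun k hk => ?_⟩
    by_contra hkj
    exact hx ((mem_tropH_iff _ _ _).2 ⟨k, hk, j, hj, hkj⟩)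
  simp [dualCell, hact]

end

/-- tropical BKK bound. For almost every coefficient vector `ω` the
intersection of the `n` tropical hypersurfaces is finite of cardinality at most
the mixed volume of the Newton polytopes. -/
theorem tropical_bkk (n : ℕ) (m : Fin n → ℕ) (hm : ∀ i, 1 ≤ m i)
    (A : ∀ i : Fin n, Fin (m i) → Fin n → ℤ) :
    ∀ᵐ ω ∂(volume : Measure (∀ i : Fin n, Fin (m i) → ℝ)),
      (⋂ i, tropH n (m i) (fun j l => ((A i j l : ℝ))) (ω i)).Finite ∧
      ((⋂ i, tropH n (m i) (fun j l => ((A i j l : ℝ))) (ω i)).ncard : ℝ) ≤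
        mixedVol n (fun i => convexHull ℝ (Set.range fun j => fun l => ((A i j l : ℝ)))) := by
  have : ∀ i, Nonempty (Fin (m i)) := fun i => ⟨⟨0, hm i⟩⟩
  filter_upwards [ae_linearIndepOn fun i j l => (A i j l : ℝ)] with ω hω
  obtain ⟨X, hX, hsum⟩ := mixedVol_newton_eq_sum (fun i j l => (A i j l : ℝ)) ω
  set T := ⋂ i, tropH n (m i) (fun j l => ((A i j l : ℝ))) (ω i) with hT
  set D : (Fin n → ℝ) → ℝ :=
    fun x => mixedVol n fun i => dualCell (fun j l => (A i j l : ℝ)) (ω i) x with hD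
  have hpos : ∀ x ∈ T, 1 ≤ D x := by
    intro x hx
    obtain ⟨j, k, hact, hind⟩ := activeSet_eq_pair_and_linearIndependent hω (Set.mem_iInter.1 hx)
    have hdiff : ∀ i, ((fun l => (A i (k i) l : ℝ)) - fun l => (A i (j i) l : ℝ)) =
        fun l => ((A i (k i) l - A i (j i) l : ℤ) : ℝ) := fun i => by
      ext l; simp
    simp only [hdiff] at hind
    simp only [hD, dualCell, hact, Set.image_pair, convexHull_pair]
    rw [mixedVol_segment]
    simp only [hdiff]
    exact one_le_abs_det_of_linearIndependent _ hind
  have hTX : T ⊆ X := fun x hx => by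
    by_contra hxX
    have h1 := hpos x hx
    rw [show D x = 0 from hX x hxX] at h1
    linarith
  have hfin : T.Finite := X.finite_toSet.subset hTX
  refine ⟨hfin, ?_⟩
  rw [hsum, Set.ncard_eq_toFinset_card T hfin]
  have hsub : hfin.toFinset ⊆ X := fun x hx => hTX (hfin.mem_toFinset.1 hx)
  have hzero : ∀ x ∈ X, x ∉ hfin.toFinset → D x = 0 := by
    intro x _ hx
    obtain ⟨i, hi⟩ : ∃ i, x ∉ tropH n (m i) (fun j l => ((A i j l : ℝ))) (ω i) := by
      simpa [hT] using hx
    exact mixedVol_dualCell_eq_zero (A := fun i j l => (A i j l : ℝ)) hi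
  calc (hfin.toFinset.card : ℝ) = ∑ x ∈ hfin.toFinset, (1 : ℝ) := by simp
    _ ≤ ∑ x ∈ hfin.toFinset, D x :=
        Finset.sum_le_sum fun x hx => hpos x (hfin.mem_toFinset.1 hx)
    _ = ∑ x ∈ X, D x := Finset.sum_subset hsub hzero
end

section
/- Let A_1, …, A_n be nonempty finite subsets of ℝ^n and let P_i := conv(A_i). Then MV(P_1, …, P_n) = 0 if and only if there exists a nonempty subset I ⊆ {1, …, n} such that the dimension of the polytope ∑_{i∈I} P_i (i.e., the rank of the vector span of its differences, equivalently the dimension of its affine span) is strictly less than |I|, where ∑_{i∈I} denotes Minkowski sum. -/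
open Pointwise MeasureTheory

theorem sum_neg_one_pow_ite_subset (n : ℕ) (R : Finset (Fin n)) :
    ∑ S : Finset (Fin n), (-1 : ℝ) ^ (n - S.card) * (if R ⊆ S then 1 else 0) =
      if R = Finset.univ then 1 else 0 := by
  have h := congrArg (Int.cast : ℤ → ℝ) (Finset.sum_powerset_neg_one_pow_card (x := Rᶜ))
  push_cast at h
  simp only [mul_ite, mul_one, mul_zero, ← Finset.sum_filter]
  calc _ = ∑ S ∈ Rᶜ.powerset, (-1 : ℝ) ^ S.card := by
        refine Finset.sum_nbij' compl compl ?_ ?_ (by simp) (by simp) ?_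
        · intro S hS
          simpa using hS
        · intro S hS
          simpa using Finset.subset_compl_comm.1 (Finset.mem_powerset.1 hS)
        · intro S _
          simp [Finset.card_compl]
    _ = _ := by rw [h]; simp

/-- Polarizing the determinant by inclusion–exclusion gives the mixed discriminant. -/
theorem sum_neg_one_pow_mul_det_sum {n : ℕ} (M : Fin n → Matrix (Fin n) (Fin n) ℝ) :
    ∑ S : Finset (Fin n), (-1 : ℝ) ^ (n - S.card) * (∑ i ∈ S, M i).det =
      ∑ σ : Equiv.Perm (Fin n), (Matrix.of fun k => M (σ k) k).det := by
  have hdet (S : Finset (Fin n)) : (∑ i ∈ S, M i).det = ∑ φ : Fin n → Fin n,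
      (if Finset.univ.image φ ⊆ S then 1 else 0) * (Matrix.of fun k => M (φ k) k).det := by
    have h := (Matrix.detRowAlternating (n := Fin n) (R := ℝ)).toMultilinearMap.map_sum_finset
      (fun k i => M i k) (fun _ => S)
    have h1 : (∑ i ∈ S, M i) = fun k => ∑ i ∈ S, M i k := by
      ext k l; simp [Matrix.sum_apply]
    rw [h1]
    refine h.trans ?_
    simp only [ite_mul, one_mul, zero_mul, ← Finset.sum_filter]
    refine Finset.sum_congr ?_ fun φ _ => rfl
    ext φ
    simp [Finset.image_subset_iff]
  simp_rw [hdet, Finset.mul_sum]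
  rw [Finset.sum_comm]
  simp_rw [← mul_assoc, ← Finset.sum_mul, sum_neg_one_pow_ite_subset, ite_mul, one_mul, zero_mul]
  rw [← Finset.sum_filter]
  symm
  refine Finset.sum_bij (fun σ _ => ⇑σ) ?_ ?_ ?_ ?_
  · intro σ _
    simp [Finset.image_univ_of_surjective σ.surjective]
  · intro σ _ τ _ h
    exact DFunLike.coe_injective h
  · intro φ hφ
    have hs : Function.Surjective φ := by
      rw [← Set.range_eq_univ, ← Finset.coe_univ, ← (Finset.mem_filter.1 hφ).2]; simp
    exact ⟨Equiv.ofBijective φ (Finite.surjective_iff_bijective.1 hs), Finset.mem_univ _, rfl⟩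
  · intro σ _; rfl

/-- The mixed discriminant of weighted sums of rank-one matrices `d dᵀ` is a weighted sum of squared
determinants. -/
theorem sum_perm_det_sum_vecMulVec {n : ℕ} {α : Type*} [DecidableEq α] (T : Fin n → Finset α)
    (w : Fin n → α → ℝ) (d : Fin n → α → Fin n → ℝ) :
    ∑ σ : Equiv.Perm (Fin n),
        (Matrix.of fun k =>
          (∑ a ∈ T (σ k), w (σ k) a • Matrix.vecMulVec (d (σ k) a) (d (σ k) a)) k).det =
      ∑ β ∈ Fintype.piFinset T,
        (∏ i, w i (β i)) * (Matrix.of fun i => d i (β i)).det ^ 2 := by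
  have hσ (σ : Equiv.Perm (Fin n)) :
      (Matrix.of fun k =>
        (∑ a ∈ T (σ k), w (σ k) a • Matrix.vecMulVec (d (σ k) a) (d (σ k) a)) k).det =
      ∑ β ∈ Fintype.piFinset T, (∏ i, w i (β i)) * (Matrix.of fun i => d i (β i)).det *
        (((Equiv.Perm.sign σ : ℤ) : ℝ) * ∏ k, d (σ k) (β (σ k)) k) := by
    have h := (Matrix.detRowAlternating (n := Fin n) (R := ℝ)).toMultilinearMap.map_sum_finset
      (fun k a => (w (σ k) a * d (σ k) a k) • d (σ k) a) (fun k => T (σ k))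
    have h1 : (Matrix.of fun k =>
        (∑ a ∈ T (σ k), w (σ k) a • Matrix.vecMulVec (d (σ k) a) (d (σ k) a)) k) =
        fun k => ∑ a ∈ T (σ k), (w (σ k) a * d (σ k) a k) • d (σ k) a := by
      ext k l
      simp [Matrix.sum_apply, Matrix.vecMulVec_apply, mul_assoc]
    rw [h1]
    refine h.trans ?_
    symm
    refine Finset.sum_bij (fun β _ k => β (σ k)) ?_ ?_ ?_ ?_
    · intro β hβ
      simp only [Fintype.mem_piFinset] at hβ ⊢
      exact fun k => hβ (σ k)
    · intro β _ γ _ h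
      funext i
      simpa using congrFun h (σ.symm i)
    · intro γ hγ
      simp only [Fintype.mem_piFinset] at hγ
      refine ⟨fun i => γ (σ.symm i), ?_, by simp⟩
      simp only [Fintype.mem_piFinset]
      intro i
      simpa using hγ (σ.symm i)
    · intro β _
      have hp := Matrix.det_permute σ (Matrix.of fun i => d i (β i))
      have hm := (Matrix.detRowAlternating (n := Fin n) (R := ℝ)).toMultilinearMap.map_smul_univ
        (fun k => w (σ k) (β (σ k)) * d (σ k) (β (σ k)) k) (fun k => d (σ k) (β (σ k)))
      refine Eq.trans ?_ hm.symm
      have hq : (Matrix.detRowAlternating (n := Fin n) (R := ℝ)).toMultilinearMap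
          (fun k => d (σ k) (β (σ k))) =
          ((Equiv.Perm.sign σ : ℤ) : ℝ) * (Matrix.of fun i => d i (β i)).det := hp
      rw [hq, Finset.prod_mul_distrib, Equiv.prod_comp σ (fun i => w i (β i)), smul_eq_mul]
      ring
  simp_rw [hσ]
  rw [Finset.sum_comm]
  refine Finset.sum_congr rfl fun β _ => ?_
  rw [← Finset.mul_sum, pow_two, ← mul_assoc]
  congr 1
  rw [Matrix.det_apply']
  rfl

section Gibbs

variable {n : ℕ}

/-- The exponential sum `∑ exp ⟨a, x⟩` over a finite set of vectors. -/
noncomputable def partitionFun (T : Finset (Fin n → ℝ)) (x : Fin n → ℝ) : ℝ :=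
  ∑ a ∈ T, Real.exp (a ⬝ᵥ x)

/-- The probability weights on `T` proportional to `exp ⟨a, x⟩`. -/
noncomputable def gibbsWeight (T : Finset (Fin n → ℝ)) (x a : Fin n → ℝ) : ℝ :=
  Real.exp (a ⬝ᵥ x) / partitionFun T x

/-- The mean of `T` under the Gibbs weights, that is, the gradient of `log (partitionFun T)`. -/
noncomputable def gibbsMean (T : Finset (Fin n → ℝ)) (x : Fin n → ℝ) : Fin n → ℝ :=
  ∑ a ∈ T, gibbsWeight T x a • a

/-- The covariance of `T` under the Gibbs weights, that is, the Hessian of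
`log (partitionFun T)`. -/
noncomputable def gibbsCov (T : Finset (Fin n → ℝ)) (x : Fin n → ℝ) :
    Matrix (Fin n) (Fin n) ℝ :=
  ∑ a ∈ T, gibbsWeight T x a • Matrix.vecMulVec (a - gibbsMean T x) (a - gibbsMean T x)

variable {T : Finset (Fin n → ℝ)}

theorem partitionFun_pos (hT : T.Nonempty) (x : Fin n → ℝ) : 0 < partitionFun T x :=
  Finset.sum_pos (fun _ _ => Real.exp_pos _) hT

theorem gibbsWeight_pos (hT : T.Nonempty) (x a : Fin n → ℝ) : 0 < gibbsWeight T x a :=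
  div_pos (Real.exp_pos _) (partitionFun_pos hT x)

theorem sum_gibbsWeight (hT : T.Nonempty) (x : Fin n → ℝ) : ∑ a ∈ T, gibbsWeight T x a = 1 := by
  simp only [gibbsWeight, ← Finset.sum_div]
  exact div_self (partitionFun_pos hT x).ne'

theorem sum_gibbsWeight_smul_sub (hT : T.Nonempty) (x c : Fin n → ℝ) :
    ∑ a ∈ T, gibbsWeight T x a • (a - c) = gibbsMean T x - c := by
  simp only [smul_sub, Finset.sum_sub_distrib, ← Finset.sum_smul, sum_gibbsWeight hT, one_smul]
  rfl

theorem gibbsMean_mem_convexHull (hT : T.Nonempty) (x : Fin n → ℝ) :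
    gibbsMean T x ∈ convexHull ℝ (T : Set (Fin n → ℝ)) :=
  (convex_convexHull ℝ _).sum_mem (fun _ _ => (gibbsWeight_pos hT x _).le) (sum_gibbsWeight hT x)
    fun _ ha => subset_convexHull ℝ _ ha

theorem continuous_partitionFun : Continuous (partitionFun T) := by
  unfold partitionFun dotProduct
  fun_prop

theorem continuous_gibbsWeight (hT : T.Nonempty) (a : Fin n → ℝ) :
    Continuous fun x => gibbsWeight T x a := by
  refine Continuous.div ?_ continuous_partitionFun fun x => (partitionFun_pos hT x).ne'
  unfold dotProduct
  fun_prop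

theorem continuous_gibbsMean (hT : T.Nonempty) : Continuous (gibbsMean T) :=
  continuous_finsetSum _ fun _ _ => (continuous_gibbsWeight hT _).smul continuous_const

theorem gibbsCov_mulVec (T : Finset (Fin n → ℝ)) (x u : Fin n → ℝ) :
    (gibbsCov T x).mulVec u =
      ∑ a ∈ T, (gibbsWeight T x a * ((a - gibbsMean T x) ⬝ᵥ u)) • (a - gibbsMean T x) := by
  simp only [gibbsCov, Matrix.sum_mulVec, Matrix.smul_mulVec, Matrix.vecMulVec_mulVec, mul_smul,
    op_smul_eq_smul]

theorem dotProduct_gibbsCov_mulVec (T : Finset (Fin n → ℝ)) (x u : Fin n → ℝ) :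
    u ⬝ᵥ (gibbsCov T x).mulVec u =
      ∑ a ∈ T, gibbsWeight T x a * ((a - gibbsMean T x) ⬝ᵥ u) ^ 2 := by
  rw [gibbsCov_mulVec, dotProduct_sum]
  refine Finset.sum_congr rfl fun a _ => ?_
  rw [dotProduct_smul, dotProduct_comm u, smul_eq_mul]
  ring

theorem posSemidef_gibbsCov (hT : T.Nonempty) (x : Fin n → ℝ) : (gibbsCov T x).PosSemidef :=
  Matrix.posSemidef_sum _ fun a _ =>
    (Matrix.posSemidef_vecMulVec_self_star (a - gibbsMean T x)).smul (gibbsWeight_pos hT x a).le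

theorem hasFDerivAt_dotProduct (a x : Fin n → ℝ) :
    HasFDerivAt (fun x => a ⬝ᵥ x) (dotProductBilin ℝ ℝ a).toContinuousLinearMap x :=
  (dotProductBilin ℝ ℝ a).toContinuousLinearMap.hasFDerivAt

theorem hasFDerivAt_log_partitionFun (hT : T.Nonempty) (x : Fin n → ℝ) :
    HasFDerivAt (fun x => Real.log (partitionFun T x))
      (dotProductBilin ℝ ℝ (gibbsMean T x)).toContinuousLinearMap x := by
  have h := (HasFDerivAt.fun_sum (u := T) fun a _ => (hasFDerivAt_dotProduct a x).exp).log
    (partitionFun_pos hT x).ne'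
  refine h.congr_fderiv ?_
  refine ContinuousLinearMap.ext fun u => ?_
  simp only [gibbsMean, gibbsWeight, Finset.mul_sum, map_sum, map_smul,
    LinearMap.coe_toContinuousLinearMap', dotProductBilin_apply_apply,
    smul_apply, sum_apply, smul_eq_mul]
  refine Finset.sum_congr rfl fun a _ => ?_
  rw [← partitionFun]
  ring

theorem hasFDerivAt_gibbsWeight (hT : T.Nonempty) (x a : Fin n → ℝ) :
    HasFDerivAt (fun x => gibbsWeight T x a)
      (gibbsWeight T x a • (dotProductBilin ℝ ℝ (a - gibbsMean T x)).toContinuousLinearMap) x := by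
  have h := ((hasFDerivAt_dotProduct a x).sub (hasFDerivAt_log_partitionFun hT x)).exp
  have h2 : (fun x => gibbsWeight T x a) =
      fun x => Real.exp (a ⬝ᵥ x - Real.log (partitionFun T x)) := by
    funext x
    rw [Real.exp_sub, Real.exp_log (partitionFun_pos hT x), gibbsWeight]
  rw [h2]
  refine h.congr_fderiv ?_
  have h3 := congrFun h2 x
  rw [h3]
  refine ContinuousLinearMap.ext fun u => ?_
  simp

theorem hasFDerivAt_gibbsMean (hT : T.Nonempty) (x : Fin n → ℝ) :
    HasFDerivAt (gibbsMean T) (Matrix.toLin' (gibbsCov T x)).toContinuousLinearMap x := by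
  have h := HasFDerivAt.fun_sum (u := T) fun a _ =>
    (hasFDerivAt_gibbsWeight hT x a).smul_const a
  refine h.congr_fderiv ?_
  refine ContinuousLinearMap.ext fun u => ?_
  have h0 : ∑ a ∈ T, (gibbsWeight T x a * ((a - gibbsMean T x) ⬝ᵥ u)) = 0 := by
    have := congrArg (· ⬝ᵥ u) (sum_gibbsWeight_smul_sub hT x (gibbsMean T x))
    simpa [sum_dotProduct] using this
  simp only [LinearMap.coe_toContinuousLinearMap', Matrix.toLin'_apply, gibbsCov_mulVec, smul_sub,
    Finset.sum_sub_distrib, ← Finset.sum_smul, h0, zero_smul, sub_zero,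
    sum_apply, ContinuousLinearMap.smulRight_apply,
    smul_apply, dotProductBilin_apply_apply, smul_eq_mul]

theorem dotProduct_le_log_partitionFun {x z : Fin n → ℝ}
    (hz : z ∈ convexHull ℝ (T : Set (Fin n → ℝ))) : z ⬝ᵥ x ≤ Real.log (partitionFun T x) := by
  have hconv : Convex ℝ {z : Fin n → ℝ | z ⬝ᵥ x ≤ Real.log (partitionFun T x)} :=
    convex_halfSpace_le ⟨fun a b => add_dotProduct a b x, fun c a => smul_dotProduct c a x⟩ _
  refine convexHull_min (fun a ha => ?_) hconv hz
  have h : Real.exp (a ⬝ᵥ x) ≤ partitionFun T x :=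
    Finset.single_le_sum (f := fun a => Real.exp (a ⬝ᵥ x)) (fun _ _ => (Real.exp_pos _).le) ha
  exact (Real.le_log_iff_exp_le ((Real.exp_pos _).trans_le h)).2 h

variable {ι : Type*} {U : ι → Finset (Fin n → ℝ)} {S : Finset ι}

theorem continuous_sum_log_partitionFun (hU : ∀ i, (U i).Nonempty) :
    Continuous fun x => ∑ i ∈ S, Real.log (partitionFun (U i) x) :=
  continuous_finsetSum _ fun i _ =>
    continuous_partitionFun.log fun x => (partitionFun_pos (hU i) x).ne'

theorem dotProduct_le_sum_log_partitionFun {x z : Fin n → ℝ}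
    (hz : z ∈ ∑ i ∈ S, convexHull ℝ (U i : Set (Fin n → ℝ))) :
    z ⬝ᵥ x ≤ ∑ i ∈ S, Real.log (partitionFun (U i) x) := by
  obtain ⟨g, hg, rfl⟩ := Set.mem_finsetSum _ _ _ |>.1 hz
  rw [sum_dotProduct]
  exact Finset.sum_le_sum fun i hi => dotProduct_le_log_partitionFun (hg hi)

theorem exists_forall_sum_log_partitionFun_sub_le (hU : ∀ i, (U i).Nonempty) {y : Fin n → ℝ}
    (hy : y ∈ interior (∑ i ∈ S, convexHull ℝ (U i : Set (Fin n → ℝ)))) :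
    ∃ x, ∀ x', ∑ i ∈ S, Real.log (partitionFun (U i) x) - y ⬝ᵥ x ≤
      ∑ i ∈ S, Real.log (partitionFun (U i) x') - y ⬝ᵥ x' := by
  refine Continuous.exists_forall_le
    (f := fun x => ∑ i ∈ S, Real.log (partitionFun (U i) x) - y ⬝ᵥ x)
    ((continuous_sum_log_partitionFun hU).sub (by unfold dotProduct; fun_prop)) ?_
  obtain ⟨ρ, hρ, hball⟩ := Metric.isOpen_iff.1 isOpen_interior y hy
  have hcoer (x : Fin n → ℝ) :
      ρ / 2 * ‖x‖ ≤ ∑ i ∈ S, Real.log (partitionFun (U i) x) - y ⬝ᵥ x := by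
    have hk (k : Fin n) (c : ℝ) (hc : |c| = ρ / 2) :
        c * x k ≤ ∑ i ∈ S, Real.log (partitionFun (U i) x) - y ⬝ᵥ x := by
      have hmem : y + Pi.single k c ∈ ∑ i ∈ S, convexHull ℝ (U i : Set (Fin n → ℝ)) := by
        refine interior_subset (hball ?_)
        rw [Metric.mem_ball, dist_eq_norm, add_sub_cancel_left, Pi.norm_single, Real.norm_eq_abs]
        linarith
      have := dotProduct_le_sum_log_partitionFun (x := x) hmem
      rw [add_dotProduct, single_dotProduct] at this
      linarith
    have h0 : 0 ≤ ∑ i ∈ S, Real.log (partitionFun (U i) x) - y ⬝ᵥ x :=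
      sub_nonneg.2 (dotProduct_le_sum_log_partitionFun (interior_subset hy))
    rw [← le_div_iff₀' (by positivity), pi_norm_le_iff_of_nonneg (by positivity)]
    intro k
    rw [le_div_iff₀' (by positivity), Real.norm_eq_abs]
    have hpos : |ρ / 2| = ρ / 2 := abs_of_pos (by positivity)
    rcases abs_choice (x k) with h | h <;> rw [h]
    · exact hk k _ hpos
    · have := hk k (-(ρ / 2)) (by rw [abs_neg, hpos])
      linarith
  refine Filter.tendsto_atTop_mono hcoer ?_
  exact (tendsto_norm_cocompact_atTop).const_mul_atTop (by positivity)

theorem interior_subset_range_sum_gibbsMean (hU : ∀ i, (U i).Nonempty) :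
    interior (∑ i ∈ S, convexHull ℝ (U i : Set (Fin n → ℝ))) ⊆
      Set.range fun x => ∑ i ∈ S, gibbsMean (U i) x := by
  intro y hy
  obtain ⟨x, hx⟩ := exists_forall_sum_log_partitionFun_sub_le hU hy
  refine ⟨x, ?_⟩
  have hd := (HasFDerivAt.fun_sum (u := S) fun i _ =>
    hasFDerivAt_log_partitionFun (hU i) x).sub (hasFDerivAt_dotProduct y x)
  have h0 := IsLocalMin.hasFDerivAt_eq_zero (Filter.Eventually.of_forall hx) hd
  refine dotProduct_eq _ _ fun u => ?_
  have := DFunLike.congr_fun h0 u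
  simp only [sub_apply, sum_apply,
    LinearMap.coe_toContinuousLinearMap', dotProductBilin_apply_apply,
    zero_apply, sub_eq_zero] at this
  rw [sum_dotProduct, this]

theorem range_sum_gibbsMean_subset (hU : ∀ i, (U i).Nonempty) :
    (Set.range fun x => ∑ i ∈ S, gibbsMean (U i) x) ⊆
      ∑ i ∈ S, convexHull ℝ (U i : Set (Fin n → ℝ)) := by
  rintro _ ⟨x, rfl⟩
  exact Set.finsetSum_mem_finsetSum _ _ _ fun i _ => gibbsMean_mem_convexHull (hU i) x

theorem convex_sum_convexHull : Convex ℝ (∑ i ∈ S, convexHull ℝ (U i : Set (Fin n → ℝ))) := by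
  rw [← convexHull_sum]
  exact convex_convexHull ℝ _

theorem isCompact_sum_convexHull :
    IsCompact (∑ i ∈ S, convexHull ℝ (U i : Set (Fin n → ℝ))) := by
  refine Finset.sum_induction _ IsCompact (fun _ _ => IsCompact.add) isCompact_singleton ?_
  exact fun i _ => (U i).finite_toSet.isCompact_convexHull ℝ

theorem volume_range_sum_gibbsMean (hU : ∀ i, (U i).Nonempty) :
    volume (Set.range fun x => ∑ i ∈ S, gibbsMean (U i) x) =
      volume (∑ i ∈ S, convexHull ℝ (U i : Set (Fin n → ℝ))) := by
  refine le_antisymm (measure_mono (range_sum_gibbsMean_subset hU)) ?_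
  refine le_trans ?_ (measure_mono (interior_subset_range_sum_gibbsMean hU))
  exact (measure_congr (interior_ae_eq_of_null_frontier
    (convex_sum_convexHull.addHaar_frontier volume))).ge

theorem hasFDerivAt_sum_gibbsMean (hU : ∀ i, (U i).Nonempty) (x : Fin n → ℝ) :
    HasFDerivAt (fun x => ∑ i ∈ S, gibbsMean (U i) x)
      (Matrix.toLin' (∑ i ∈ S, gibbsCov (U i) x)).toContinuousLinearMap x := by
  refine (HasFDerivAt.fun_sum fun i _ => hasFDerivAt_gibbsMean (hU i) x).congr_fderiv ?_
  simp

theorem gibbsMean_dotProduct_of_const (hT : T.Nonempty) {x u a : Fin n → ℝ} (ha : a ∈ T)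
    (hu : ∀ a ∈ T, ∀ b ∈ T, a ⬝ᵥ u = b ⬝ᵥ u) : gibbsMean T x ⬝ᵥ u = a ⬝ᵥ u := by
  rw [gibbsMean, sum_dotProduct]
  calc _ = ∑ b ∈ T, gibbsWeight T x b * (a ⬝ᵥ u) :=
        Finset.sum_congr rfl fun b hb => by rw [smul_dotProduct, hu b hb a ha, smul_eq_mul]
    _ = _ := by rw [← Finset.sum_mul, sum_gibbsWeight hT, one_mul]

theorem dotProduct_eq_of_dotProduct_gibbsCov_eq_zero (hT : T.Nonempty) {x u : Fin n → ℝ}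
    (h : u ⬝ᵥ (gibbsCov T x).mulVec u = 0) : ∀ a ∈ T, ∀ b ∈ T, a ⬝ᵥ u = b ⬝ᵥ u := by
  rw [dotProduct_gibbsCov_mulVec, Finset.sum_eq_zero_iff_of_nonneg fun a _ =>
    mul_nonneg (gibbsWeight_pos hT x a).le (sq_nonneg _)] at h
  have h' (a) (ha : a ∈ T) : a ⬝ᵥ u = gibbsMean T x ⬝ᵥ u := by
    have := (mul_eq_zero.1 (h a ha)).resolve_left (gibbsWeight_pos hT x a).ne'
    rwa [sq_eq_zero_iff, sub_dotProduct, sub_eq_zero] at this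
  exact fun a ha b hb => (h' a ha).trans (h' b hb).symm

theorem injective_sum_gibbsMean (hU : ∀ i, (U i).Nonempty)
    (hS : ∀ u : Fin n → ℝ, (∀ i ∈ S, ∀ a ∈ U i, ∀ b ∈ U i, a ⬝ᵥ u = b ⬝ᵥ u) → u = 0) :
    Function.Injective fun x => ∑ i ∈ S, gibbsMean (U i) x := by
  intro x y hxy
  by_contra hne
  have hu : x - y ≠ 0 := sub_ne_zero.2 hne
  set u := x - y with hu_def
  have hd (t : ℝ) : HasDerivAt (fun t : ℝ => u ⬝ᵥ ∑ i ∈ S, gibbsMean (U i) (y + t • u))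
      (u ⬝ᵥ (∑ i ∈ S, gibbsCov (U i) (y + t • u)).mulVec u) t := by
    have hl : HasDerivAt (fun t : ℝ => y + t • u) u t := by
      simpa using ((hasDerivAt_id t).smul_const u).const_add y
    have hm : HasDerivAt (fun t : ℝ => ∑ i ∈ S, gibbsMean (U i) (y + t • u))
        ((∑ i ∈ S, gibbsCov (U i) (y + t • u)).mulVec u) t := by
      have hg := hasFDerivAt_sum_gibbsMean (S := S) hU (y + t • u)
      exact hg.comp_hasDerivAt t hl
    exact (hasFDerivAt_dotProduct u _).comp_hasDerivAt t hm
  have hpos (t : ℝ) : 0 < u ⬝ᵥ (∑ i ∈ S, gibbsCov (U i) (y + t • u)).mulVec u := by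
    rw [Matrix.sum_mulVec, dotProduct_sum]
    have hnn (i) (_ : i ∈ S) : 0 ≤ u ⬝ᵥ (gibbsCov (U i) (y + t • u)).mulVec u := by
      rw [dotProduct_gibbsCov_mulVec]
      exact Finset.sum_nonneg fun a _ =>
        mul_nonneg (gibbsWeight_pos (hU i) _ a).le (sq_nonneg _)
    refine (Finset.sum_nonneg hnn).lt_of_ne' fun h0 => hu (hS u fun i hi => ?_)
    exact dotProduct_eq_of_dotProduct_gibbsCov_eq_zero (hU i)
      ((Finset.sum_eq_zero_iff_of_nonneg hnn).1 h0 i hi)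
  have hmono := strictMono_of_hasDerivAt_pos hd hpos
  have := hmono zero_lt_one
  have hxu : y + u = x := by simp [hu_def]
  simp only [zero_smul, add_zero, one_smul, hxu] at this
  rw [show ∑ i ∈ S, gibbsMean (U i) x = ∑ i ∈ S, gibbsMean (U i) y from hxy] at this
  exact lt_irrefl _ this

theorem det_sum_gibbsCov_eq_zero (hU : ∀ i, (U i).Nonempty) {u : Fin n → ℝ} (hu : u ≠ 0)
    (h : ∀ i ∈ S, ∀ a ∈ U i, ∀ b ∈ U i, a ⬝ᵥ u = b ⬝ᵥ u) (x : Fin n → ℝ) :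
    (∑ i ∈ S, gibbsCov (U i) x).det = 0 := by
  refine Matrix.exists_mulVec_eq_zero_iff.1 ⟨u, hu, ?_⟩
  rw [Matrix.sum_mulVec]
  refine Finset.sum_eq_zero fun i hi => ?_
  rw [gibbsCov_mulVec]
  refine Finset.sum_eq_zero fun a ha => ?_
  rw [sub_dotProduct, gibbsMean_dotProduct_of_const (hU i) ha (h i hi), sub_self, mul_zero,
    zero_smul]

theorem det_sum_gibbsCov_nonneg (hU : ∀ i, (U i).Nonempty) (x : Fin n → ℝ) :
    0 ≤ (∑ i ∈ S, gibbsCov (U i) x).det :=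
  (Matrix.posSemidef_sum _ fun i _ => posSemidef_gibbsCov (hU i) x).det_nonneg

theorem volume_eq_zero_of_dotProduct_const {s : Set (Fin n → ℝ)} {u : Fin n → ℝ} (hu : u ≠ 0)
    (h : ∀ a ∈ s, ∀ b ∈ s, a ⬝ᵥ u = b ⬝ᵥ u) : volume s = 0 := by
  rcases s.eq_empty_or_nonempty with rfl | ⟨a, ha⟩
  · exact measure_empty
  · let L : (Fin n → ℝ) →ₗ[ℝ] ℝ := dotProductBilin ℝ ℝ u
    refine measure_mono_null (t := (AffineSubspace.mk' a L.ker : Set (Fin n → ℝ))) ?_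
      (Measure.addHaar_affineSubspace _ _ ?_)
    · intro b hb
      simp [L, AffineSubspace.mem_mk', dotProduct_comm u, h b hb a ha]
    · intro htop
      have h1 := congrArg AffineSubspace.direction htop
      rw [AffineSubspace.direction_mk', AffineSubspace.direction_top] at h1
      have h2 : u ∈ L.ker := h1 ▸ Submodule.mem_top
      exact hu (dotProduct_self_eq_zero.1 h2)

theorem volume_sum_convexHull_eq_zero {u : Fin n → ℝ} (hu : u ≠ 0)
    (h : ∀ i ∈ S, ∀ a ∈ U i, ∀ b ∈ U i, a ⬝ᵥ u = b ⬝ᵥ u) :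
    volume (∑ i ∈ S, convexHull ℝ (U i : Set (Fin n → ℝ))) = 0 := by
  refine volume_eq_zero_of_dotProduct_const hu fun y hy z hz => ?_
  have hconst (i) (hi : i ∈ S) (a) (ha : a ∈ convexHull ℝ (U i : Set (Fin n → ℝ))) (b)
      (hb : b ∈ convexHull ℝ (U i : Set (Fin n → ℝ))) : a ⬝ᵥ u = b ⬝ᵥ u := by
    have hlin : IsLinearMap ℝ fun z : Fin n → ℝ => z ⬝ᵥ u :=
      ⟨fun a b => add_dotProduct a b u, fun c a => smul_dotProduct c a u⟩
    have h1 (c) (hc : c ∈ U i) : a ⬝ᵥ u = c ⬝ᵥ u :=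
      convexHull_min (t := {z | z ⬝ᵥ u = c ⬝ᵥ u}) (fun d hd => h i hi d hd c hc)
        (convex_hyperplane hlin _) ha
    exact (convexHull_min (t := {z | z ⬝ᵥ u = a ⬝ᵥ u}) (fun d hd => (h1 d hd).symm)
        (convex_hyperplane hlin _) hb).symm
  obtain ⟨g, hg, rfl⟩ := Set.mem_finsetSum _ _ _ |>.1 hy
  obtain ⟨k, hk, rfl⟩ := Set.mem_finsetSum _ _ _ |>.1 hz
  rw [sum_dotProduct, sum_dotProduct]
  exact Finset.sum_congr rfl fun i hi => hconst i hi _ (hg hi) _ (hk hi)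

/-- The volume of a Minkowski sum of polytopes is the integral of the Hessian determinant of the
sum of the log-partition functions, by the change of variables along its gradient. -/
theorem integrable_det_sum_gibbsCov_and_integral_eq (hU : ∀ i, (U i).Nonempty) :
    Integrable (fun x => (∑ i ∈ S, gibbsCov (U i) x).det) ∧
      ∫ x, (∑ i ∈ S, gibbsCov (U i) x).det =
        (volume (∑ i ∈ S, convexHull ℝ (U i : Set (Fin n → ℝ)))).toReal := by
  by_cases hS : ∃ u : Fin n → ℝ, u ≠ 0 ∧ ∀ i ∈ S, ∀ a ∈ U i, ∀ b ∈ U i, a ⬝ᵥ u = b ⬝ᵥ u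
  · obtain ⟨u, hu, h⟩ := hS
    simp [det_sum_gibbsCov_eq_zero hU hu h, volume_sum_convexHull_eq_zero hu h]
  · push Not at hS
    have hinj : Set.InjOn (fun x => ∑ i ∈ S, gibbsMean (U i) x) Set.univ :=
      (injective_sum_gibbsMean hU fun u h => by
        by_contra hu
        obtain ⟨i, hi, a, ha, b, hb, hab⟩ := hS u hu
        exact hab (h i hi a ha b hb)).injOn
    have hd (x) (_ : x ∈ Set.univ) := (hasFDerivAt_sum_gibbsMean (S := S) hU x).hasFDerivWithinAt
      (s := Set.univ)
    have hi := integrableOn_image_iff_integrableOn_abs_det_fderiv_smul volume MeasurableSet.univ hd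
      hinj fun _ => (1 : ℝ)
    have he := integral_image_eq_integral_abs_det_fderiv_smul volume MeasurableSet.univ hd
      hinj fun _ => (1 : ℝ)
    have hdet (x : Fin n → ℝ) :
        |(Matrix.toLin' (∑ i ∈ S, gibbsCov (U i) x)).toContinuousLinearMap.det| • (1 : ℝ) =
          (∑ i ∈ S, gibbsCov (U i) x).det := by
      rw [ContinuousLinearMap.det, LinearMap.coe_toContinuousLinearMap, LinearMap.det_toLin',
        abs_of_nonneg (det_sum_gibbsCov_nonneg hU x), smul_eq_mul, mul_one]
    simp only [hdet, Set.image_univ, integrableOn_univ, Measure.restrict_univ] at hi he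
    refine ⟨hi.1 ?_, ?_⟩
    · rw [integrableOn_const_iff, volume_range_sum_gibbsMean hU]
      exact Or.inr isCompact_sum_convexHull.measure_lt_top
    · rw [← he, setIntegral_const, smul_eq_mul, mul_one, Measure.real,
        volume_range_sum_gibbsMean hU]

end Gibbs

/-- **Rado's theorem** for families of finite sets of vectors. -/
theorem exists_linearIndependent_of_forall_card_le_finrank {K V ι : Type*} [Field K]
    [AddCommGroup V] [Module K V] [FiniteDimensional K V] [Finite ι] (D : ι → Finset V)
    (h : ∀ I : Finset ι,
      I.card ≤ Module.finrank K (⨆ i ∈ I, Submodule.span K (D i : Set V) : Submodule K V)) :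
    ∃ v : ι → V, (∀ i, v i ∈ D i) ∧ LinearIndependent K v := by
  classical
  have := Fintype.ofFinite ι
  induction hN : ∑ i, (D i).card using Nat.strong_induction_on generalizing D with
  | _ N ih =>
  have hne (i : ι) : (D i).Nonempty := by
    rw [Finset.nonempty_iff_ne_empty]
    intro hi
    simpa [hi] using h {i}
  by_cases hone : ∀ i, (D i).card ≤ 1
  · choose v hv using hne
    have hD (i : ι) : D i = {v i} := by
      refine Finset.eq_singleton_iff_unique_mem.2 ⟨hv i, fun z hz => ?_⟩
      exact Finset.card_le_one.1 (hone i) z hz (v i) (hv i)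
    refine ⟨v, hv, linearIndependent_iff_card_le_finrank_span.2 ?_⟩
    have := h Finset.univ
    have heq : (⨆ i ∈ (Finset.univ : Finset ι), Submodule.span K (D i : Set V)) =
        Submodule.span K (Set.range v) := by
      simp [hD, ← Submodule.span_iUnion, Set.iUnion_singleton_eq_range]
    rwa [heq, Finset.card_univ] at this
  · push Not at hone
    obtain ⟨j, hj⟩ := hone
    obtain ⟨x, hx, y, hy, hxy⟩ := Finset.one_lt_card.1 hj
    let E (z : V) : ι → Finset V := Function.update D j ((D j).erase z)
    have hEsub (z : V) (i : ι) : E z i ⊆ D i := by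
      by_cases hi : i = j
      · subst hi; simpa [E] using Finset.erase_subset z (D i)
      · simp [E, hi]
    have hcase : ∀ z ∈ D j, (∀ I : Finset ι, I.card ≤
        Module.finrank K (⨆ i ∈ I, Submodule.span K (E z i : Set V) : Submodule K V)) →
        ∃ v : ι → V, (∀ i, v i ∈ D i) ∧ LinearIndependent K v := by
      intro z hz hE
      obtain ⟨v, hv, hli⟩ := ih (∑ i, (E z i).card) (by
        rw [← hN]
        refine Finset.sum_lt_sum (fun i _ => Finset.card_le_card (hEsub z i))
          ⟨j, Finset.mem_univ j, ?_⟩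
        simpa [E] using Finset.card_erase_lt_of_mem hz) (E z) hE rfl
      exact ⟨v, fun i => hEsub z i (hv i), hli⟩
    by_contra hcon
    have hviol : ∀ z ∈ D j, ∃ I : Finset ι, j ∈ I ∧
        Module.finrank K (⨆ i ∈ I, Submodule.span K (E z i : Set V) : Submodule K V) < I.card := by
      intro z hz
      by_contra! hno
      refine hcon (hcase z hz fun I => ?_)
      by_cases hjI : j ∈ I
      · exact hno I hjI
      · have heq : (⨆ i ∈ I, Submodule.span K (E z i : Set V)) =
            ⨆ i ∈ I, Submodule.span K (D i : Set V) := by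
          refine iSup_congr fun i => iSup_congr fun hi => ?_
          have : i ≠ j := fun hij => hjI (hij ▸ hi)
          simp [E, this]
        rw [heq]
        exact h I
    obtain ⟨I, hjI, hI⟩ := hviol x hx
    obtain ⟨J, hjJ, hJ⟩ := hviol y hy
    set W₁ : Submodule K V := ⨆ i ∈ I, Submodule.span K (E x i : Set V)
    set W₂ : Submodule K V := ⨆ i ∈ J, Submodule.span K (E y i : Set V)
    have hle {z : V} {L : Finset ι} {i : ι} (hi : i ∈ L) :
        Submodule.span K (E z i : Set V) ≤ ⨆ i ∈ L, Submodule.span K (E z i : Set V) :=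
      le_iSup₂_of_le i hi le_rfl
    have hE {z : V} {i : ι} (hi : i ≠ j) : E z i = D i := by simp [E, hi]
    have hsup : (⨆ i ∈ I ∪ J, Submodule.span K (D i : Set V)) ≤ W₁ ⊔ W₂ := by
      refine iSup₂_le fun i hi => ?_
      by_cases hij : i = j
      · subst hij
        refine Submodule.span_le.2 fun z hz => ?_
        by_cases hzx : z = x
        · refine Submodule.mem_sup_right (hle hjJ (Submodule.subset_span ?_))
          have : z ≠ y := hzx ▸ hxy
          simpa [E, this] using hz
        · refine Submodule.mem_sup_left (hle hjI (Submodule.subset_span ?_))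
          simpa [E, hzx] using hz
      · rcases Finset.mem_union.1 hi with hi | hi
        · rw [← hE (z := x) hij]
          exact (hle hi).trans le_sup_left
        · rw [← hE (z := y) hij]
          exact (hle hi).trans le_sup_right
    have hinf : (⨆ i ∈ (I ∩ J).erase j, Submodule.span K (D i : Set V)) ≤ W₁ ⊓ W₂ := by
      refine iSup₂_le fun i hi => ?_
      obtain ⟨hij, hi⟩ := Finset.mem_erase.1 hi
      obtain ⟨hiI, hiJ⟩ := Finset.mem_inter.1 hi
      refine le_inf ?_ ?_
      · rw [← hE (z := x) hij]
        exact hle hiI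
      · rw [← hE (z := y) hij]
        exact hle hiJ
    have h1 := (h (I ∪ J)).trans (Submodule.finrank_mono hsup)
    have h2 := (h ((I ∩ J).erase j)).trans (Submodule.finrank_mono hinf)
    have h3 := Submodule.finrank_sup_add_finrank_inf_eq W₁ W₂
    have h4 := Finset.card_union_add_card_inter I J
    have h5 := Finset.card_erase_add_one (Finset.mem_inter.2 ⟨hjI, hjJ⟩)
    omega

theorem vectorSpan_sum_convexHull {V ι : Type*} [AddCommGroup V] [Module ℝ V]
    (I : Finset ι) (A : ι → Set V) (m : ι → V) (hm : ∀ i, m i ∈ convexHull ℝ (A i)) :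
    vectorSpan ℝ (∑ i ∈ I, convexHull ℝ (A i)) =
      ⨆ i ∈ I, Submodule.span ℝ ((fun a => a - m i) '' A i) := by
  classical
  refine le_antisymm ?_ (iSup₂_le fun i hi => Submodule.span_le.2 ?_)
  · refine Submodule.span_le.2 ?_
    rintro _ ⟨y, hy, z, hz, rfl⟩
    obtain ⟨g, hg, rfl⟩ := Set.mem_finsetSum _ _ _ |>.1 hy
    obtain ⟨k, hk, rfl⟩ := Set.mem_finsetSum _ _ _ |>.1 hz
    simp only [vsub_eq_sub, ← Finset.sum_sub_distrib]
    refine Submodule.sum_mem _ fun i hi => ?_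
    refine (le_iSup₂_of_le (f := fun i _ => Submodule.span ℝ ((fun a => a - m i) '' A i)) i hi
      le_rfl) ?_
    have hmem {b : V} (hb : b ∈ convexHull ℝ (A i)) :
        b - m i ∈ Submodule.span ℝ ((fun a => a - m i) '' A i) :=
      convexHull_min (t := AffineSubspace.mk' (m i) (Submodule.span ℝ ((fun a => a - m i) '' A i)))
        (fun a ha => Submodule.subset_span (Set.mem_image_of_mem _ ha))
        (AffineSubspace.convex _) hb
    simpa using Submodule.sub_mem _ (hmem (hg hi)) (hmem (hk hi))
  · rintro _ ⟨a, ha, rfl⟩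
    have h1 : ∑ j ∈ I, Function.update m i a j ∈ ∑ i ∈ I, convexHull ℝ (A i) := by
      refine Set.finsetSum_mem_finsetSum _ _ _ fun j _ => ?_
      by_cases hj : j = i
      · subst hj; simpa using subset_convexHull ℝ _ ha
      · simpa [hj] using hm j
    have h2 := vsub_mem_vectorSpan ℝ h1 (Set.finsetSum_mem_finsetSum I _ m fun j _ => hm j)
    rw [vsub_eq_sub, Finset.sum_update_of_mem hi, ← Finset.add_sum_erase I m hi,
      Finset.sdiff_singleton_eq_erase, add_sub_add_right_eq_sub] at h2
    exact h2

theorem mixedVol_eq_integral {n : ℕ} {T : Fin n → Finset (Fin n → ℝ)}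
    (hT : ∀ i, (T i).Nonempty) :
    mixedVol n (fun i => convexHull ℝ (T i : Set (Fin n → ℝ))) =
        ∫ x, ∑ β ∈ Fintype.piFinset T, (∏ i, gibbsWeight (T i) x (β i)) *
          (Matrix.of fun i => β i - gibbsMean (T i) x).det ^ 2 ∧
      Integrable fun x => ∑ β ∈ Fintype.piFinset T, (∏ i, gibbsWeight (T i) x (β i)) *
        (Matrix.of fun i => β i - gibbsMean (T i) x).det ^ 2 := by
  have hpt (x : Fin n → ℝ) :
      ∑ β ∈ Fintype.piFinset T, (∏ i, gibbsWeight (T i) x (β i)) *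
        (Matrix.of fun i => β i - gibbsMean (T i) x).det ^ 2 =
      ∑ S : Finset (Fin n), (-1 : ℝ) ^ (n - S.card) * (∑ i ∈ S, gibbsCov (T i) x).det := by
    rw [sum_neg_one_pow_mul_det_sum]
    exact (sum_perm_det_sum_vecMulVec T (fun i => gibbsWeight (T i) x)
      (fun i a => a - gibbsMean (T i) x)).symm
  have hint (S : Finset (Fin n)) := integrable_det_sum_gibbsCov_and_integral_eq (S := S) hT
  simp_rw [hpt]
  refine ⟨?_, integrable_finsetSum _ fun S _ => (hint S).1.const_mul _⟩
  rw [integral_finsetSum _ fun S _ => (hint S).1.const_mul _]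
  exact Finset.sum_congr rfl fun S _ => by rw [integral_const_mul, (hint S).2]

theorem mixedVol_convexHull_eq_zero_iff_det {n : ℕ} {T : Fin n → Finset (Fin n → ℝ)}
    (hT : ∀ i, (T i).Nonempty) :
    mixedVol n (fun i => convexHull ℝ (T i : Set (Fin n → ℝ))) = 0 ↔
      ∀ x, ∀ β ∈ Fintype.piFinset T, (Matrix.of fun i => β i - gibbsMean (T i) x).det = 0 := by
  obtain ⟨hvol, hint⟩ := mixedVol_eq_integral hT
  have hw (x : Fin n → ℝ) (β : Fin n → Fin n → ℝ) : 0 < ∏ i, gibbsWeight (T i) x (β i) :=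
    Finset.prod_pos fun i _ => gibbsWeight_pos (hT i) x (β i)
  have hnn (x : Fin n → ℝ) (β) (_ : β ∈ Fintype.piFinset T) :
      0 ≤ (∏ i, gibbsWeight (T i) x (β i)) *
        (Matrix.of fun i => β i - gibbsMean (T i) x).det ^ 2 :=
    mul_nonneg (hw x β).le (sq_nonneg _)
  have hcont : Continuous fun x => ∑ β ∈ Fintype.piFinset T, (∏ i, gibbsWeight (T i) x (β i)) *
      (Matrix.of fun i => β i - gibbsMean (T i) x).det ^ 2 := by
    refine continuous_finsetSum _ fun β _ => .mul ?_ (.pow (.matrix_det ?_) 2)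
    · exact continuous_finsetProd _ fun i _ => continuous_gibbsWeight (hT i) (β i)
    · exact continuous_pi fun i => continuous_const.sub (continuous_gibbsMean (hT i))
  rw [hvol, integral_eq_zero_iff_of_nonneg (fun x => Finset.sum_nonneg (hnn x)) hint,
    hcont.ae_eq_iff_eq volume continuous_zero, funext_iff]
  refine forall_congr' fun x => ?_
  rw [Pi.zero_apply, Finset.sum_eq_zero_iff_of_nonneg (hnn x)]
  refine forall₂_congr fun β _ => ?_
  rw [mul_eq_zero, or_iff_right (hw x β).ne', sq_eq_zero_iff]

/-- the mixed volume of the polytopes `Pᵢ = conv(Aᵢ)` vanishes if and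
only if there is a nonempty index set `I` such that the Minkowski sum `∑_{i ∈ I} Pᵢ`
has dimension (the rank of the span of its differences) strictly less than `|I|`. -/
theorem mixedVol_eq_zero_iff (n : ℕ) (A : Fin n → Set (Fin n → ℝ))
    (hfin : ∀ i, (A i).Finite) (hne : ∀ i, (A i).Nonempty) :
    mixedVol n (fun i => convexHull ℝ (A i)) = 0 ↔
      ∃ I : Finset (Fin n), I.Nonempty ∧
        Module.finrank ℝ (vectorSpan ℝ (∑ i ∈ I, convexHull ℝ (A i))) < I.card := by
  obtain ⟨T, rfl⟩ : ∃ T : Fin n → Finset (Fin n → ℝ), A = fun i => (T i : Set (Fin n → ℝ)) :=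
    ⟨fun i => (hfin i).toFinset, by simp⟩
  have hT (i) : (T i).Nonempty := Finset.coe_nonempty.1 (hne i)
  have hspan (x : Fin n → ℝ) (I : Finset (Fin n)) :=
    vectorSpan_sum_convexHull I (fun i => (T i : Set (Fin n → ℝ))) (fun i => gibbsMean (T i) x)
      fun i => gibbsMean_mem_convexHull (hT i) x
  rw [mixedVol_convexHull_eq_zero_iff_det hT]
  constructor
  · intro h
    by_contra! hcon
    obtain ⟨v, hv, hli⟩ := exists_linearIndependent_of_forall_card_le_finrank (K := ℝ)
      (fun i => (T i).image fun a => a - gibbsMean (T i) 0) fun I => by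
        rcases I.eq_empty_or_nonempty with rfl | hI
        · simp
        · refine (hcon I hI).trans (Submodule.finrank_mono ?_)
          rw [hspan 0 I]
          simp only [Finset.coe_image, le_refl]
    simp only [Finset.mem_image] at hv
    choose β hβ hβv using hv
    have hdet := h 0 β (Fintype.mem_piFinset.2 hβ)
    simp only [hβv] at hdet
    have hu := (Matrix.linearIndependent_rows_iff_isUnit (A := Matrix.of v)).1 hli
    exact ((Matrix.isUnit_iff_isUnit_det _).1 hu).ne_zero hdet
  · rintro ⟨I, -, hI⟩ x β hβ
    by_contra hdet
    have hli : LinearIndependent ℝ fun i => β i - gibbsMean (T i) x :=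
      Matrix.linearIndependent_rows_of_det_ne_zero hdet
    have hliI : LinearIndependent ℝ fun i : I => β i - gibbsMean (T i) x :=
      hli.comp _ Subtype.val_injective
    have hcard := finrank_span_eq_card hliI
    rw [Fintype.card_coe] at hcard
    refine hI.not_ge (hcard ▸ Submodule.finrank_mono ?_)
    rw [hspan x I, Submodule.span_le]
    rintro _ ⟨i, rfl⟩
    refine (le_iSup₂_of_le (f := fun i _ => Submodule.span ℝ
      ((fun a => a - gibbsMean (T i) x) '' (T i : Set (Fin n → ℝ)))) i.1 i.2 le_rfl) ?_
    exact Submodule.subset_span (Set.mem_image_of_mem _ (Fintype.mem_piFinset.1 hβ i))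
end
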